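/- For every natural number n ≥ 4, one has d(2n−7, 7) = c_n − 6·c_{n−1} + 10·c_{n−2} − 4·c_{n−3}. -/

import Mathlib

open Finset

/-- Step value: `true` is an up-step (+1), `false` a down-step (−1). -/
def dyckStep (b : Bool) : ℤ := if b then 1 else -1

/-- Sum of the first `k` steps of the path `w`. -/
def dyckPSum {m : ℕ} (w : Fin m → Bool) (k : ℕ) : ℤ :=
  ∑ t ∈ Finset.univ.filter (fun t : Fin m => (t : ℕ) < k), dyckStep (w t)

/-- `dyckD i j`: the number of lattice paths of length `i` from `(0,0)` to `(i,j)`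
using steps `(1,1)` and `(1,-1)` that never go below the x-axis; equivalently the
number of `±1`-lists of length `i` all of whose partial sums are nonnegative and
whose total sum is `j`. -/
def dyckD (i j : ℕ) : ℕ :=
  (Finset.univ.filter (fun w : Fin i → Bool =>
    (∀ k ≤ i, 0 ≤ dyckPSum w k) ∧ dyckPSum w i = (j : ℤ))).card

theorem dyckPSum_snoc_of_le {m k : ℕ} (w : Fin m → Bool) (b : Bool) (hk : k ≤ m) :
    dyckPSum (Fin.snoc w b : Fin (m + 1) → Bool) k = dyckPSum w k := by
  simp [dyckPSum, Finset.sum_filter, Fin.sum_univ_castSucc, hk.not_gt]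

theorem dyckPSum_snoc_last {m : ℕ} (w : Fin m → Bool) (b : Bool) :
    dyckPSum (Fin.snoc w b : Fin (m + 1) → Bool) (m + 1) = dyckPSum w m + dyckStep b := by
  simp [dyckPSum, Finset.sum_filter, Fin.sum_univ_castSucc]

theorem snoc_nonneg_and_sum_eq_iff {m j : ℕ} (w : Fin m → Bool) (b : Bool) :
    ((∀ k ≤ m + 1, 0 ≤ dyckPSum (Fin.snoc w b : Fin (m + 1) → Bool) k) ∧
      dyckPSum (Fin.snoc w b : Fin (m + 1) → Bool) (m + 1) = j) ↔
    (∀ k ≤ m, 0 ≤ dyckPSum w k) ∧ dyckPSum w m + dyckStep b = j := by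
  rw [dyckPSum_snoc_last]
  refine and_congr_left fun h => ⟨fun H k hk => ?_, fun H k hk => ?_⟩
  · rw [← dyckPSum_snoc_of_le w b hk]
    exact H k (by omega)
  · rcases Nat.le_succ_iff.mp hk with hk | rfl
    · rw [dyckPSum_snoc_of_le w b hk]
      exact H k hk
    · rw [Nat.succ_eq_add_one, dyckPSum_snoc_last, h]
      positivity

/-- Counting paths of length `i + 1` according to their last step. -/
theorem dyckD_succ (i j : ℕ) :
    dyckD (i + 1) j =
      (univ.filter fun w : Fin i → Bool =>
        (∀ k ≤ i, 0 ≤ dyckPSum w k) ∧ dyckPSum w i + 1 = j).card +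
      (univ.filter fun w : Fin i → Bool =>
        (∀ k ≤ i, 0 ≤ dyckPSum w k) ∧ dyckPSum w i - 1 = j).card := by
  have hsnoc (b : Bool) (w : Fin i → Bool) :
      Fin.snocEquiv (fun _ : Fin (i + 1) => Bool) (b, w) = Fin.snoc w b := rfl
  simp only [dyckD, Finset.card_filter]
  rw [← (Fin.snocEquiv fun _ : Fin (i + 1) => Bool).sum_comp, Fintype.sum_prod_type,
    Fintype.sum_bool]
  simp only [hsnoc, snoc_nonneg_and_sum_eq_iff]
  simp [dyckStep, sub_eq_add_neg]

theorem dyckD_succ_zero (i : ℕ) : dyckD (i + 1) 0 = dyckD i 1 := by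
  rw [dyckD_succ, Finset.card_eq_zero.mpr, zero_add, dyckD]
  · congr! 3
    push_cast
    grind
  · refine Finset.filter_eq_empty_iff.mpr fun w _ h => ?_
    have := h.1 i le_rfl
    have := h.2
    push_cast at this
    omega

theorem dyckD_succ_succ (i j : ℕ) :
    dyckD (i + 1) (j + 1) = dyckD i j + dyckD i (j + 2) := by
  rw [dyckD_succ, dyckD, dyckD]
  congr! 4 <;> push_cast <;> grind

theorem dyckD_zero_left (j : ℕ) : dyckD 0 j = if j = 0 then 1 else 0 := by
  split_ifs with h <;> simp [dyckD, dyckPSum, h, eq_comm]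

/-- The ballot formula: a path from `0` to `j` of length `i` has `u` up-steps where
`i + j = 2 * u`. -/
theorem dyckD_add_choose (i j u : ℕ) (h : i + j = 2 * u) :
    dyckD i j + i.choose (u + 1) = i.choose u := by
  induction i generalizing j u with
  | zero =>
    rw [dyckD_zero_left]
    rcases u with _ | u
    · simp_all
    · simp [show j ≠ 0 by omega]
  | succ i ih =>
    obtain ⟨u, rfl⟩ : ∃ v, u = v + 1 := ⟨u - 1, by omega⟩
    rw [Nat.choose_succ_succ, Nat.choose_succ_succ]
    rcases j with _ | j
    · have hsymm : i.choose u = i.choose (u + 1) := Nat.choose_symm_of_eq_add (by omega)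
      have := ih 1 (u + 1) (by omega)
      rw [dyckD_succ_zero]
      simp only [Nat.succ_eq_add_one] at *
      omega
    · have h₁ := ih j u (by omega)
      have h₂ := ih (j + 2) (u + 1) (by omega)
      rw [dyckD_succ_succ]
      simp only [Nat.succ_eq_add_one] at *
      omega

theorem dyckD_two_mul_zero (n : ℕ) : dyckD (2 * n) 0 = catalan n := by
  have h := dyckD_add_choose (2 * n) 0 n rfl
  have hc := succ_mul_catalan_eq_centralBinom n
  have hs := Nat.choose_succ_right_eq (2 * n) n
  rw [Nat.centralBinom_eq_two_mul_choose] at hc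
  rw [show 2 * n - n = n by omega] at hs
  apply Nat.eq_of_mul_eq_mul_left n.succ_pos
  rw [Nat.succ_eq_add_one]
  linarith [congrArg (· * (n + 1)) h]

/-- For `n ≥ 4`, `d(2n−7, 7) = cₙ − 6·cₙ₋₁ + 10·cₙ₋₂ − 4·cₙ₋₃`. -/
theorem dyckD_isoline_seven (n : ℕ) (hn : 4 ≤ n) :
    (dyckD (2 * n - 7) 7 : ℤ) =
      catalan n - 6 * catalan (n - 1) + 10 * catalan (n - 2)
        - 4 * catalan (n - 3) := by
  obtain ⟨m, rfl⟩ : ∃ m, n = m + 4 := ⟨n - 4, by omega⟩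
  rw [show 2 * (m + 4) - 7 = 2 * m + 1 by omega, show m + 4 - 1 = m + 3 by omega,
    show m + 4 - 2 = m + 2 by omega, show m + 4 - 3 = m + 1 by omega]
  have hcat (k : ℕ) : dyckD (2 * m + 2 * k + 2) 0 = catalan (m + k + 1) := by
    rw [← dyckD_two_mul_zero, show 2 * m + 2 * k + 2 = 2 * (m + k + 1) by ring]
  have h₁ := hcat 0
  have h₂ := hcat 1
  have h₃ := hcat 2
  have h₄ := hcat 3
  have hz := fun k : ℕ => dyckD_succ_zero (2 * m + k)
  have hs := fun k j : ℕ => dyckD_succ_succ (2 * m + k) j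
  have := hz 1; have := hz 3; have := hz 5; have := hz 7
  have := hs 1 1; have := hs 1 3; have := hs 1 5
  have := hs 2 0; have := hs 2 2; have := hs 2 4
  have := hs 3 1; have := hs 3 3
  have := hs 4 0; have := hs 4 2
  have := hs 5 1
  have := hs 6 0
  norm_num [add_assoc] at *
  omega
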